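/- Let f be a monic matrix polynomial of degree 2m (A_0 = I_q) and suppose Hermitian q×q matrices s_0, ..., s_{2m-1} are Markov parameters of f. Then f is a Hurwitz-type matrix (HTM) polynomial if and only if H_{1,m-1} and H_{2,m-1} are positive definite and f(z) = (−1)^m ( P_{1,m}^♯(−z²) − z·Q_{1,m}^♯(−z²) ) for all z ∈ ℂ, where P_{1,m} and Q_{1,m} are the matrix polynomials built from s_0, ..., s_{2m-1}. -/

import Mathlib

open Matrix MeasureTheory
open scoped ComplexOrder

noncomputable section

/-- The space of `q × q` complex matrices. -/
abbrev Mat (q : ℕ) := Matrix (Fin q) (Fin q) ℂ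

/-- The h-part of an even-degree matrix polynomial
`f(z) = A 0 * z^(2m) + ... + A (2m)`:  `h(z) = A 0 * z^m + A 2 * z^(m-1) + ... + A (2m)`. -/
def hEven (q m : ℕ) (A : ℕ → Mat q) (z : ℂ) : Mat q :=
  ∑ j ∈ Finset.range (m + 1), z ^ (m - j) • A (2 * j)

/-- The g-part of an even-degree matrix polynomial:
`g(z) = A 1 * z^(m-1) + A 3 * z^(m-2) + ... + A (2m-1)`. -/
def gEven (q m : ℕ) (A : ℕ → Mat q) (z : ℂ) : Mat q :=
  ∑ j ∈ Finset.range m, z ^ (m - 1 - j) • A (2 * j + 1)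

/-- The h-part of an odd-degree matrix polynomial
`f(z) = A 0 * z^(2m+1) + ... + A (2m+1)`:  `h(z) = A 1 * z^m + ... + A (2m+1)`. -/
def hOdd (q m : ℕ) (A : ℕ → Mat q) (z : ℂ) : Mat q :=
  ∑ j ∈ Finset.range (m + 1), z ^ (m - j) • A (2 * j + 1)

/-- The g-part of an odd-degree matrix polynomial: `g(z) = A 0 * z^m + ... + A (2m)`. -/
def gOdd (q m : ℕ) (A : ℕ → Mat q) (z : ℂ) : Mat q :=
  ∑ j ∈ Finset.range (m + 1), z ^ (m - j) • A (2 * j)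

/-- The matrix polynomial `f(z) = A 0 * z^n + A 1 * z^(n-1) + ... + A n`. -/
def fPoly (q n : ℕ) (A : ℕ → Mat q) (z : ℂ) : Mat q :=
  ∑ j ∈ Finset.range (n + 1), z ^ (n - j) • A j

/-- Continued fraction for the even case:  `wEven q m c d j z = w_{m-1-j}(z)`, where
`w_{m-1}(z) = z c_{m-1} + d_{m-1}⁻¹` and `w_k(z) = z c_k + (d_k + w_{k+1}(z)⁻¹)⁻¹`. -/
def wEven (q m : ℕ) (c d : ℕ → Mat q) : ℕ → ℂ → Mat q
  | 0, z => z • c (m - 1) + (d (m - 1))⁻¹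
  | j + 1, z => z • c (m - 2 - j) + (d (m - 2 - j) + (wEven q m c d j z)⁻¹)⁻¹

/-- Continued fraction for the odd case:  `wOdd q m c d j z = w_{m-1-j}(z)`, where
`w_{m-1}(z) = z c_{m-1} + (d_{m-1} + z⁻¹ c_m⁻¹)⁻¹`. -/
def wOdd (q m : ℕ) (c d : ℕ → Mat q) : ℕ → ℂ → Mat q
  | 0, z => z • c (m - 1) + (d (m - 1) + z⁻¹ • (c m)⁻¹)⁻¹
  | j + 1, z => z • c (m - 2 - j) + (d (m - 2 - j) + (wOdd q m c d j z)⁻¹)⁻¹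

/-- A Hurwitz-type matrix polynomial of degree 2m, described through its h-part and g-part:
there are Hermitian positive definite matrices `c_0, ..., c_{m-1}`, `d_0, ..., d_{m-1}` with
`g(z) h(z)⁻¹ = w_0(z)⁻¹` whenever `det (h z) ≠ 0` and all inverses in the recursion exist. -/
def IsHTMEven (q m : ℕ) (h g : ℂ → Mat q) : Prop :=
  ∃ c d : ℕ → Mat q,
    (∀ k < m, (c k).PosDef) ∧ (∀ k < m, (d k).PosDef) ∧
    ∀ z : ℂ, (h z).det ≠ 0 →
      (∀ j < m, IsUnit (wEven q m c d j z).det) →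
      (∀ j, j + 1 < m → IsUnit (d (m - 2 - j) + (wEven q m c d j z)⁻¹).det) →
      g z * (h z)⁻¹ = (wEven q m c d (m - 1) z)⁻¹

/-- A Hurwitz-type matrix polynomial of degree 2m+1, described through its h-part and g-part:
there are Hermitian positive definite matrices `c_0, ..., c_m`, `d_0, ..., d_{m-1}` with
`h(z) (z g(z))⁻¹ = w_0(z)⁻¹` whenever `z ≠ 0`, `det (g z) ≠ 0` and all inverses exist. -/
def IsHTMOdd (q m : ℕ) (h g : ℂ → Mat q) : Prop :=
  ∃ c d : ℕ → Mat q,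
    (∀ k ≤ m, (c k).PosDef) ∧ (∀ k < m, (d k).PosDef) ∧
    ∀ z : ℂ, z ≠ 0 → (g z).det ≠ 0 →
      IsUnit (d (m - 1) + z⁻¹ • (c m)⁻¹).det →
      (∀ j < m, IsUnit (wOdd q m c d j z).det) →
      (∀ j, j + 1 < m → IsUnit (d (m - 2 - j) + (wOdd q m c d j z)⁻¹).det) →
      h z * (z • g z)⁻¹ = (wOdd q m c d (m - 1) z)⁻¹

/-- `s_0, ..., s_{2m-1}` are Markov parameters of the even-degree polynomial with
coefficients `A`:  `z^(2m) g(z) - (∑_{j<2m} (-1)^j s_j z^(2m-1-j)) h(z)` has degree ≤ m-1. -/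
def MarkovEven (q m : ℕ) (A s : ℕ → Mat q) : Prop :=
  ∃ B : ℕ → Mat q, ∀ z : ℂ,
    z ^ (2 * m) • gEven q m A z
      - (∑ j ∈ Finset.range (2 * m), ((-1 : ℂ) ^ j * z ^ (2 * m - 1 - j)) • s j) * hEven q m A z
    = ∑ k ∈ Finset.range m, z ^ k • B k

/-- `s_0, ..., s_{2m}` are Markov parameters of the odd-degree polynomial with coefficients
`A`:  `z^(2m+1) h(z) - (∑_{j≤2m} (-1)^j s_j z^(2m-j)) z g(z)` has degree ≤ m. -/
def MarkovOdd (q m : ℕ) (A s : ℕ → Mat q) : Prop :=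
  ∃ B : ℕ → Mat q, ∀ z : ℂ,
    z ^ (2 * m + 1) • hOdd q m A z
      - (∑ j ∈ Finset.range (2 * m + 1), ((-1 : ℂ) ^ j * z ^ (2 * m - j)) • s j) *
          (z • gOdd q m A z)
    = ∑ k ∈ Finset.range (m + 1), z ^ k • B k

/-- The block Hankel matrix `H_{1,n-1} = (s_{i+j})_{i,j=0}^{n-1}` with `n` block rows. -/
def H1b (q : ℕ) (s : ℕ → Mat q) (n : ℕ) : Matrix (Fin n × Fin q) (Fin n × Fin q) ℂ :=
  Matrix.of fun p r => s ((p.1 : ℕ) + (r.1 : ℕ)) p.2 r.2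

/-- The block Hankel matrix `H_{2,n-1} = (s_{i+j+1})_{i,j=0}^{n-1}` with `n` block rows. -/
def H2b (q : ℕ) (s : ℕ → Mat q) (n : ℕ) : Matrix (Fin n × Fin q) (Fin n × Fin q) ℂ :=
  Matrix.of fun p r => s ((p.1 : ℕ) + (r.1 : ℕ) + 1) p.2 r.2

/-- The block column `Y_{1,n} = (s_n; s_{n+1}; ...; s_{2n-1})`. -/
def Y1b (q : ℕ) (s : ℕ → Mat q) (n : ℕ) : Matrix (Fin n × Fin q) (Fin q) ℂ :=
  Matrix.of fun p b => s (n + (p.1 : ℕ)) p.2 b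

/-- The block column `Y_{2,n} = (s_{n+1}; ...; s_{2n})`. -/
def Y2b (q : ℕ) (s : ℕ → Mat q) (n : ℕ) : Matrix (Fin n × Fin q) (Fin q) ℂ :=
  Matrix.of fun p b => s (n + 1 + (p.1 : ℕ)) p.2 b

/-- The block column `col (I, z I, ..., z^(n-1) I)`. -/
def colPow (q n : ℕ) (z : ℂ) : Matrix (Fin n × Fin q) (Fin q) ℂ :=
  Matrix.of fun p b => z ^ (p.1 : ℕ) * (if p.2 = b then 1 else 0)

/-- `r_i(z) = ∑_{k=1}^{i} z^(i-k) s_{k-1}`. -/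
def rPol (q : ℕ) (s : ℕ → Mat q) (i : ℕ) (z : ℂ) : Mat q :=
  ∑ k ∈ Finset.range i, z ^ (i - 1 - k) • s k

/-- `t_i(z) = ∑_{k=0}^{i} z^(i-k) s_k`. -/
def tPol (q : ℕ) (s : ℕ → Mat q) (i : ℕ) (z : ℂ) : Mat q :=
  ∑ k ∈ Finset.range (i + 1), z ^ (i - k) • s k

/-- The block column `col (r_0(z), ..., r_{n-1}(z))`. -/
def colR (q : ℕ) (s : ℕ → Mat q) (n : ℕ) (z : ℂ) : Matrix (Fin n × Fin q) (Fin q) ℂ :=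
  Matrix.of fun p b => rPol q s (p.1 : ℕ) z p.2 b

/-- The block column `col (t_0(z), ..., t_{n-1}(z))`. -/
def colT (q : ℕ) (s : ℕ → Mat q) (n : ℕ) (z : ℂ) : Matrix (Fin n × Fin q) (Fin q) ℂ :=
  Matrix.of fun p b => tPol q s (p.1 : ℕ) z p.2 b

/-- `P_{1,j}(z) = z^j I - Y_{1,j}^* H_{1,j-1}⁻¹ col(I, zI, ..., z^(j-1) I)`. -/
def P1 (q : ℕ) (s : ℕ → Mat q) (j : ℕ) (z : ℂ) : Mat q :=
  z ^ j • (1 : Mat q) - (Y1b q s j)ᴴ * (H1b q s j)⁻¹ * colPow q j z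

/-- `P_{2,j}(z) = z^j I - Y_{2,j}^* H_{2,j-1}⁻¹ col(I, zI, ..., z^(j-1) I)`. -/
def P2 (q : ℕ) (s : ℕ → Mat q) (j : ℕ) (z : ℂ) : Mat q :=
  z ^ j • (1 : Mat q) - (Y2b q s j)ᴴ * (H2b q s j)⁻¹ * colPow q j z

/-- `Q_{1,j}(z) = r_j(z) - Y_{1,j}^* H_{1,j-1}⁻¹ col(r_0(z), ..., r_{j-1}(z))`. -/
def Q1 (q : ℕ) (s : ℕ → Mat q) (j : ℕ) (z : ℂ) : Mat q :=
  rPol q s j z - (Y1b q s j)ᴴ * (H1b q s j)⁻¹ * colR q s j z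

/-- `Q_{2,j}(z) = t_j(z) - Y_{2,j}^* H_{2,j-1}⁻¹ col(t_0(z), ..., t_{j-1}(z))`. -/
def Q2 (q : ℕ) (s : ℕ → Mat q) (j : ℕ) (z : ℂ) : Mat q :=
  tPol q s j z - (Y2b q s j)ᴴ * (H2b q s j)⁻¹ * colT q s j z

/-- The block column `e = (I; 0; ...; 0)` with `n` blocks. -/
def eCol (q n : ℕ) : Matrix (Fin n × Fin q) (Fin q) ℂ :=
  Matrix.of fun p b => if (p.1 : ℕ) = 0 then (if p.2 = b then 1 else 0) else 0

/-- The block column `y = (s_0; s_1; ...; s_{n-1})`. -/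
def yCol (q : ℕ) (s : ℕ → Mat q) (n : ℕ) : Matrix (Fin n × Fin q) (Fin q) ℂ :=
  Matrix.of fun p b => s (p.1 : ℕ) p.2 b

/-- Condition C: `A_i^* A_k = A_k^* A_i` for every odd `i` and even `k` with `i, k ≤ n`. -/
def CondC (q n : ℕ) (A : ℕ → Mat q) : Prop :=
  ∀ i k, i ≤ n → k ≤ n → i % 2 = 1 → k % 2 = 0 → (A i)ᴴ * A k = (A k)ᴴ * A i

/-- The symmetrizer: for a polynomial with (descending) coefficients `Q_0, ..., Q_{n-1}`
(read off as `Q_j = A (2j)`), the `n × n` block Hankel matrix whose `(i,k)` block is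
`A (2(n-1-i-k))` if `i + k ≤ n - 1`, and `0` otherwise. -/
def Sh (q n : ℕ) (A : ℕ → Mat q) : Matrix (Fin n × Fin q) (Fin n × Fin q) ℂ :=
  Matrix.of fun p r =>
    if (p.1 : ℕ) + (r.1 : ℕ) ≤ n - 1 then A (2 * (n - 1 - (p.1 : ℕ) - (r.1 : ℕ))) p.2 r.2
    else 0

/-- The signature matrix `J̃ = diag (I, -I, I, ..., ±I)` with `n` blocks. -/
def Jt (q n : ℕ) : Matrix (Fin n × Fin q) (Fin n × Fin q) ℂ :=
  Matrix.diagonal (fun p => (-1 : ℂ) ^ (p.1 : ℕ))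

/-- The block row `(I, x² I, ..., x^(2n-2) I)`. -/
def Rev (q n : ℕ) (x : ℂ) : Matrix (Fin q) (Fin n × Fin q) ℂ :=
  Matrix.of fun a p => x ^ (2 * (p.1 : ℕ)) * (if a = p.2 then 1 else 0)

/-- The block column `(I; y² I; ...; y^(2n-2) I)`. -/
def Cev (q n : ℕ) (y : ℂ) : Matrix (Fin n × Fin q) (Fin q) ℂ :=
  Matrix.of fun p b => y ^ (2 * (p.1 : ℕ)) * (if p.2 = b then 1 else 0)

/-- The block row `(x I, x³ I, ..., x^(2n-1) I)`. -/
def Rod (q n : ℕ) (x : ℂ) : Matrix (Fin q) (Fin n × Fin q) ℂ :=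
  Matrix.of fun a p => x ^ (2 * (p.1 : ℕ) + 1) * (if a = p.2 then 1 else 0)

/-- The block column `(y I; y³ I; ...; y^(2n-1) I)`. -/
def Cod (q n : ℕ) (y : ℂ) : Matrix (Fin n × Fin q) (Fin q) ℂ :=
  Matrix.of fun p b => y ^ (2 * (p.1 : ℕ) + 1) * (if p.2 = b then 1 else 0)

section BlockMatrices

variable {q : ℕ}

/-- The block matrix with `n × k` blocks `P i j`. -/
def blockMat (P : ℕ → ℕ → Mat q) (n k : ℕ) : Matrix (Fin n × Fin q) (Fin k × Fin q) ℂ :=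
  Matrix.of fun p r => P p.1 r.1 p.2 r.2

/-- The block column with `n` blocks `Y i`. -/
def blockCol (Y : ℕ → Mat q) (n : ℕ) : Matrix (Fin n × Fin q) (Fin q) ℂ :=
  Matrix.of fun p b => Y p.1 p.2 b

theorem blockMat_mul_blockMat (P Q : ℕ → ℕ → Mat q) (n k l : ℕ) :
    blockMat P n k * blockMat Q k l =
      blockMat (fun i j => ∑ t ∈ Finset.range k, P i t * Q t j) n l := by
  ext ⟨i, a⟩ ⟨j, b⟩
  simp [blockMat, Matrix.mul_apply, Fintype.sum_prod_type, Matrix.sum_apply,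
    Finset.sum_range]

theorem blockMat_mul_blockCol (P : ℕ → ℕ → Mat q) (Y : ℕ → Mat q) (n k : ℕ) :
    blockMat P n k * blockCol Y k =
      blockCol (fun i => ∑ t ∈ Finset.range k, P i t * Y t) n := by
  ext ⟨i, a⟩ b
  simp [blockMat, blockCol, Matrix.mul_apply, Fintype.sum_prod_type, Matrix.sum_apply,
    Finset.sum_range]

theorem conjTranspose_blockMat (P : ℕ → ℕ → Mat q) (n k : ℕ) :
    (blockMat P n k)ᴴ = blockMat (fun i j => (P j i)ᴴ) k n := by
  ext ⟨i, a⟩ ⟨j, b⟩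
  simp [blockMat]

theorem conjTranspose_blockCol_mul_blockCol (Y Z : ℕ → Mat q) (n : ℕ) :
    (blockCol Y n)ᴴ * blockCol Z n = ∑ t ∈ Finset.range n, (Y t)ᴴ * Z t := by
  ext a b
  simp [blockCol, Matrix.mul_apply, Fintype.sum_prod_type, Matrix.sum_apply, Finset.sum_range]

theorem exists_blockCol_eq {n : ℕ} (M : Matrix (Fin n × Fin q) (Fin q) ℂ) :
    ∃ Y : ℕ → Mat q, blockCol Y n = M := by
  refine ⟨fun i => if h : i < n then Matrix.of fun a b => M (⟨i, h⟩, a) b else 0, ?_⟩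
  ext ⟨i, a⟩ b
  simp [blockCol]

theorem blockCol_eq_iff {Y Z : ℕ → Mat q} {n : ℕ} :
    blockCol Y n = blockCol Z n ↔ ∀ i < n, Y i = Z i := by
  constructor
  · intro h i hi
    ext a b
    simpa [blockCol] using congrFun (congrFun h (⟨i, hi⟩, a)) b
  · intro h
    ext ⟨i, a⟩ b
    simp [blockCol, h i i.2]

theorem isUnit_blockMat_of_upperTriangular {P : ℕ → ℕ → Mat q} {n : ℕ}
    (hlow : ∀ i j, j < i → P i j = 0) (hdiag : ∀ i < n, IsUnit (P i i)) :
    IsUnit (blockMat P n n) := by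
  rw [Matrix.isUnit_iff_isUnit_det]
  have hT : (blockMat P n n).BlockTriangular Prod.fst := by
    rintro ⟨i, a⟩ ⟨j, b⟩ h
    simp only [blockMat, Matrix.of_apply]
    rw [hlow i j h, Matrix.zero_apply]
  rw [hT.det_fintype, IsUnit.prod_univ_iff]
  intro k
  let e : Fin q ≃ {p : Fin n × Fin q // p.1 = k} :=
    { toFun := fun a => ⟨(k, a), rfl⟩
      invFun := fun p => p.1.2
      left_inv := fun a => rfl
      right_inv := by rintro ⟨⟨i, a⟩, rfl⟩; rfl }
  have he : ((blockMat P n n).toSquareBlock Prod.fst k).submatrix e e = P k k := by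
    ext a b
    rfl
  rw [← Matrix.det_submatrix_equiv_self e, he, ← Matrix.isUnit_iff_isUnit_det]
  exact hdiag k k.2

theorem posDef_blockMat_diagonal {D : ℕ → Mat q} {n : ℕ} (hD : ∀ i < n, (D i).PosDef) :
    (blockMat (fun i j => if i = j then D i else 0) n n).PosDef := by
  apply Matrix.PosDef.of_dotProduct_mulVec_pos
  · rw [Matrix.IsHermitian, conjTranspose_blockMat]
    ext ⟨i, a⟩ ⟨j, b⟩
    by_cases h : (j : ℕ) = i
    · simp only [blockMat, Matrix.of_apply, h, if_true]
      rw [(hD i i.2).1]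
    · simp [blockMat, h, Ne.symm h]
  · intro x hx
    have key : star x ⬝ᵥ (blockMat (fun i j => if i = j then D i else 0) n n) *ᵥ x =
        ∑ i : Fin n, star (fun a => x (i, a)) ⬝ᵥ D i *ᵥ (fun a => x (i, a)) := by
      simp only [dotProduct, mulVec, Fintype.sum_prod_type, blockMat, Matrix.of_apply]
      refine Finset.sum_congr rfl fun i _ => Finset.sum_congr rfl fun a _ => ?_
      rw [Finset.sum_eq_single i]
      · simp
      · intro j _ hj
        have : ¬ (i : ℕ) = j := fun h => hj (Fin.ext h.symm)
        simp [this]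
      · simp
    rw [key]
    obtain ⟨⟨i, a⟩, hia⟩ := Function.ne_iff.mp hx
    refine Finset.sum_pos' (fun k _ => (hD k k.2).posSemidef.dotProduct_mulVec_nonneg _)
      ⟨i, Finset.mem_univ _, (hD i i.2).dotProduct_mulVec_pos ?_⟩
    exact fun h => hia (congrFun h a)

end BlockMatrices

section StieltjesChain

variable {q : ℕ}

/-- One step of the symmetric nearest-neighbour recursion with weights `a`. -/
def hop (a : ℕ → Mat q) (φ : ℕ → Mat q) : ℕ → Mat q
  | 0 => a 1 * φ 1
  | k + 1 => a k * φ k + a (k + 2) * φ (k + 2)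

/-- The iterates of `hop`, started from the identity matrix at site `0`. -/
def krylov (a : ℕ → Mat q) : ℕ → ℕ → Mat q
  | 0 => fun k => if k = 0 then 1 else 0
  | n + 1 => hop a (krylov a n)

/-- The sesquilinear pairing with weights `a 0, ..., a (M - 1)`. -/
def pairing (a : ℕ → Mat q) (M : ℕ) (φ ψ : ℕ → Mat q) : Mat q :=
  ∑ k ∈ Finset.range M, (φ k)ᴴ * a k * ψ k

/-- The Stieltjes moments generated by the weights `a`. -/
def moment (a : ℕ → Mat q) (n : ℕ) : Mat q := a 0 * krylov a (2 * n) 0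

theorem krylov_eq_zero_of_lt (a : ℕ → Mat q) (n k : ℕ) (h : n < k) : krylov a n k = 0 := by
  induction n generalizing k with
  | zero => simp [krylov, h.ne']
  | succ n ih =>
    obtain _ | k := k
    · omega
    · simp [krylov, hop, ih k (by omega), ih (k + 2) (by omega)]

theorem krylov_eq_zero_of_parity (a : ℕ → Mat q) (n k : ℕ) (h : n % 2 ≠ k % 2) :
    krylov a n k = 0 := by
  induction n generalizing k with
  | zero =>
    have : k ≠ 0 := by rintro rfl; simp at h
    simp [krylov, this]
  | succ n ih =>
    obtain _ | k := k
    · simp [krylov, hop, ih 1 (by omega)]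
    · simp [krylov, hop, ih k (by omega), ih (k + 2) (by omega)]

theorem isUnit_krylov_self {a : ℕ → Mat q} {n : ℕ} (h : ∀ k < n, IsUnit (a k)) :
    IsUnit (krylov a n n) := by
  induction n with
  | zero => simp [krylov]
  | succ n ih =>
    have : krylov a (n + 1) (n + 1) = a n * krylov a n n := by
      simp [krylov, hop, krylov_eq_zero_of_lt a n (n + 2) (by omega)]
    rw [this]
    exact (h n (by omega)).mul (ih fun k hk => h k (by omega))

theorem krylov_update {a : ℕ → Mat q} {N n : ℕ} (x : Mat q) (h : n ≤ N) :
    krylov (Function.update a N x) n = krylov a n := by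
  induction n with
  | zero => rfl
  | succ n ih =>
    have key : ∀ k, Function.update a N x k * krylov a n k = a k * krylov a n k := by
      intro k
      by_cases hk : k = N
      · subst hk
        rw [krylov_eq_zero_of_lt a n k (by omega)]
        simp
      · rw [Function.update_of_ne hk]
    funext k
    obtain _ | k := k
    · simp only [krylov, hop, ih (by omega), key]
    · simp only [krylov, hop, ih (by omega), key]

theorem pairing_hop_sub {a : ℕ → Mat q} (ha : ∀ k, (a k).IsHermitian) (M : ℕ)
    (φ ψ : ℕ → Mat q) :
    pairing a (M + 1) φ (hop a ψ) - pairing a (M + 1) (hop a φ) ψ =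
      (φ M)ᴴ * a M * a (M + 1) * ψ (M + 1) - (φ (M + 1))ᴴ * a (M + 1) * a M * ψ M := by
  have ha' : ∀ k, (a k)ᴴ = a k := ha
  induction M with
  | zero => simp [pairing, hop, ha', Matrix.mul_assoc]
  | succ M ih =>
    unfold pairing at ih ⊢
    rw [Finset.sum_range_succ, Finset.sum_range_succ (fun k => (hop a φ k)ᴴ * a k * ψ k),
      add_sub_add_comm, ih]
    simp only [hop, Matrix.conjTranspose_add, Matrix.conjTranspose_mul, ha']
    noncomm_ring

theorem pairing_hop {a : ℕ → Mat q} (ha : ∀ k, (a k).IsHermitian) {M : ℕ} (hM : a M = 0)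
    (φ ψ : ℕ → Mat q) : pairing a M φ (hop a ψ) = pairing a M (hop a φ) ψ := by
  obtain _ | M := M
  · simp [pairing]
  · rw [← sub_eq_zero, pairing_hop_sub ha, hM]
    simp

theorem pairing_krylov {a : ℕ → Mat q} (ha : ∀ k, (a k).IsHermitian) {M : ℕ} (hM : a M = 0)
    {i j n : ℕ} (h : i + j = 2 * n) :
    pairing a M (krylov a i) (krylov a j) = moment a n := by
  induction i generalizing j with
  | zero =>
    obtain rfl : j = 2 * n := by omega
    obtain _ | M := M
    · simp [pairing, moment, hM]
    · simp [pairing, moment, krylov, Finset.sum_range_succ']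
  | succ i ih =>
    rw [← ih (j := j + 1) (by omega)]
    exact (pairing_hop ha hM _ _).symm

theorem isHermitian_moment {a : ℕ → Mat q} (ha : ∀ k, (a k).IsHermitian) {M : ℕ}
    (hM : a M = 0) (n : ℕ) : (moment a n).IsHermitian := by
  rw [← pairing_krylov ha hM (two_mul n).symm]
  unfold pairing
  rw [Matrix.IsHermitian, Matrix.conjTranspose_sum]
  refine Finset.sum_congr rfl fun k _ => ?_
  simp [Matrix.mul_assoc, (ha k).eq]

/-- Only the sites with the parity of `e` contribute to the pairing. -/
theorem sum_range_two_mul_of_parity {M : Type*} [AddCommMonoid M] (f : ℕ → M) {e : ℕ}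
    (he : e < 2) (hf : ∀ k, k % 2 ≠ e → f k = 0) (m : ℕ) :
    ∑ k ∈ Finset.range (2 * m), f k = ∑ k ∈ Finset.range m, f (2 * k + e) := by
  induction m with
  | zero => simp
  | succ m ih =>
    rw [show 2 * (m + 1) = 2 * m + 1 + 1 by ring, Finset.sum_range_succ, Finset.sum_range_succ,
      Finset.sum_range_succ, ih, add_assoc]
    congr 1
    obtain rfl | rfl : e = 0 ∨ e = 1 := by omega
    · rw [hf (2 * m + 1) (by omega)]; simp
    · rw [hf (2 * m) (by omega)]; simp

theorem posDef_hankel_moment {a : ℕ → Mat q} {m e : ℕ} (he : e < 2)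
    (ha : ∀ k, (a k).IsHermitian) (hpos : ∀ k < 2 * m, (a k).PosDef) (hzero : a (2 * m) = 0) :
    (blockMat (fun i j => moment a (i + j + e)) m m).PosDef := by
  have hfac : blockMat (fun i j => moment a (i + j + e)) m m =
      (blockMat (fun k j => krylov a (2 * j + e) (2 * k + e)) m m)ᴴ *
        blockMat (fun i j => if i = j then a (2 * i + e) else 0) m m *
        blockMat (fun k j => krylov a (2 * j + e) (2 * k + e)) m m := by
    rw [conjTranspose_blockMat, blockMat_mul_blockMat, blockMat_mul_blockMat]
    ext ⟨i, b⟩ ⟨j, c⟩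
    simp only [blockMat, Matrix.of_apply]
    refine congrFun (congrFun ?_ b) c
    rw [← pairing_krylov ha hzero (i := 2 * i + e) (j := 2 * j + e) (by ring), pairing,
      sum_range_two_mul_of_parity _ he]
    · refine Finset.sum_congr rfl fun k hk => ?_
      congr 1
      simp only [mul_ite, mul_zero, Finset.sum_ite_eq', hk, if_true]
    · intro k hk
      rw [krylov_eq_zero_of_parity a (2 * j + e) k (by omega), mul_zero]
  rw [hfac]
  refine (posDef_blockMat_diagonal fun i hi => hpos _ (by omega)).conjTranspose_mul_mul_same ?_
  refine Matrix.mulVec_injective_of_isUnit (isUnit_blockMat_of_upperTriangular ?_ ?_)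
  · intro i j h
    exact krylov_eq_zero_of_lt a _ _ (by omega)
  · intro i hi
    exact isUnit_krylov_self fun k hk => (hpos k (by omega)).isUnit

/-- A combination of the first iterates, with leading coefficient `1`, which vanishes at
all sites before the last one. -/
theorem exists_krylov_combination {a : ℕ → Mat q} {n m e : ℕ} (he : e < 2) (hn : n < m)
    (ha : ∀ k < 2 * n + e, IsUnit (a k)) :
    ∃ Y : ℕ → Mat q, Y n = 1 ∧ (∀ j, n < j → Y j = 0) ∧
      ∀ k < 2 * n + e, ∑ j ∈ Finset.range m, krylov a (2 * j + e) k * Y j = 0 := by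
  have hU : IsUnit (blockMat (fun k j => krylov a (2 * j + e) (2 * k + e)) n n) := by
    refine isUnit_blockMat_of_upperTriangular ?_ ?_
    · intro i j h
      exact krylov_eq_zero_of_lt a _ _ (by omega)
    · intro i hi
      exact isUnit_krylov_self fun k hk => ha k (by omega)
  obtain ⟨Z, hZ⟩ := exists_blockCol_eq
    ((blockMat (fun k j => krylov a (2 * j + e) (2 * k + e)) n n)⁻¹ *
      blockCol (fun k => - krylov a (2 * n + e) (2 * k + e)) n)
  have hZ' := congrArg (blockMat (fun k j => krylov a (2 * j + e) (2 * k + e)) n n * ·) hZ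
  simp only [← Matrix.mul_assoc] at hZ'
  rw [Matrix.mul_nonsing_inv _ ((Matrix.isUnit_iff_isUnit_det _).mp hU), Matrix.one_mul,
    blockMat_mul_blockCol, blockCol_eq_iff] at hZ'
  refine ⟨fun j => if j < n then Z j else if j = n then 1 else 0, by simp, ?_, ?_⟩
  · intro j hj
    simp [hj.ne', hj.not_gt]
  · intro k hk
    by_cases hpar : k % 2 = e
    · obtain ⟨l, rfl⟩ : ∃ l, k = 2 * l + e := ⟨k / 2, by omega⟩
      have hsub : ∑ j ∈ Finset.range (n + 1), krylov a (2 * j + e) (2 * l + e) *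
          (if j < n then Z j else if j = n then 1 else 0) = 0 := by
        rw [Finset.sum_range_succ, Finset.sum_congr rfl (g := fun j =>
          krylov a (2 * j + e) (2 * l + e) * Z j), hZ' l (by omega)]
        · simp
        · intro j hj
          rw [if_pos (Finset.mem_range.mp hj)]
      refine Eq.trans (Finset.sum_subset ?_ ?_).symm hsub
      · exact Finset.range_mono (by omega)
      · intro j _ hj
        have hj' : n < j := by simpa using hj
        simp [hj'.ne', hj'.not_gt]
    · refine Finset.sum_eq_zero fun j _ => ?_
      rw [krylov_eq_zero_of_parity a _ k (by omega), zero_mul]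

/-- If the first `2 n + e` moments are `s`, the defect in the next moment is positive. -/
theorem posDef_moment_defect {a s : ℕ → Mat q} {n m e : ℕ} (he : e < 2) (hn : n < m)
    (ha : ∀ k, (a k).IsHermitian) (hpos : ∀ k < 2 * n + e, (a k).PosDef)
    (hzero : ∀ k, 2 * n + e ≤ k → a k = 0) (hs : ∀ j < 2 * n + e, moment a j = s j)
    (hH : (blockMat (fun i j => s (i + j + e)) m m).PosDef) :
    (s (2 * n + e) - moment a (2 * n + e)).PosDef := by
  obtain ⟨Y, hYn, hY, hYa⟩ := exists_krylov_combination he hn fun k hk => (hpos k hk).isUnit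
  have h0 : ∑ i ∈ Finset.range m, ∑ j ∈ Finset.range m,
      (Y i)ᴴ * moment a (i + j + e) * Y j = 0 := by
    have hp : ∀ i j, (Y i)ᴴ * moment a (i + j + e) * Y j = ∑ k ∈ Finset.range (2 * n + e),
        (krylov a (2 * i + e) k * Y i)ᴴ * a k * (krylov a (2 * j + e) k * Y j) := by
      intro i j
      rw [← pairing_krylov ha (hzero _ le_rfl) (i := 2 * i + e) (j := 2 * j + e) (by ring),
        pairing, Finset.mul_sum, Finset.sum_mul]
      refine Finset.sum_congr rfl fun k _ => ?_
      simp only [Matrix.conjTranspose_mul, Matrix.mul_assoc]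
    simp only [hp]
    calc _ = ∑ k ∈ Finset.range (2 * n + e),
          (∑ i ∈ Finset.range m, krylov a (2 * i + e) k * Y i)ᴴ * a k *
            (∑ j ∈ Finset.range m, krylov a (2 * j + e) k * Y j) := by
          simp only [Matrix.conjTranspose_sum, Finset.sum_mul, Finset.mul_sum]
          rw [Finset.sum_congr rfl fun i _ => Finset.sum_comm, Finset.sum_comm]
          exact Finset.sum_congr rfl fun k _ => Finset.sum_comm
      _ = 0 := by
          refine Finset.sum_eq_zero fun k hk => ?_
          rw [hYa k (Finset.mem_range.mp hk), mul_zero]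
  have hdefect : s (2 * n + e) - moment a (2 * n + e) =
      (blockCol Y m)ᴴ * blockMat (fun i j => s (i + j + e)) m m * blockCol Y m := by
    rw [Matrix.mul_assoc, blockMat_mul_blockCol, conjTranspose_blockCol_mul_blockCol]
    simp only [Finset.mul_sum]
    rw [← sub_zero (∑ i ∈ Finset.range m, _), ← h0, ← Finset.sum_sub_distrib]
    simp only [← Finset.sum_sub_distrib]
    have hterm : ∀ i j, (Y i)ᴴ * (s (i + j + e) * Y j) - (Y i)ᴴ * moment a (i + j + e) * Y j =
        if i = n then (if j = n then s (2 * n + e) - moment a (2 * n + e) else 0) else 0 := by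
      intro i j
      by_cases hin : n < i
      · simp [hY i hin, hin.ne']
      by_cases hjn : n < j
      · simp [hY j hjn, hjn.ne']
      by_cases hij : i + j + e < 2 * n + e
      · rw [hs _ hij]
        have : ¬ (i = n ∧ j = n) := by omega
        rw [← ite_and, if_neg this, Matrix.mul_assoc, sub_self]
      · obtain ⟨rfl, rfl⟩ : i = n ∧ j = i := by omega
        simp [hYn, two_mul]
    simp only [hterm]
    simp [hn]
  rw [hdefect]
  refine hH.conjTranspose_mul_mul_same fun v w hvw => ?_
  funext b
  have := congrFun hvw (⟨n, hn⟩, b)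
  simpa [blockCol, Matrix.mulVec, dotProduct, hYn, Matrix.one_apply] using this

theorem moment_update_of_lt {a : ℕ → Mat q} (ha : ∀ k, (a k).IsHermitian) {N : ℕ}
    {x : Mat q} (hx : x.IsHermitian) (hzero : ∀ k, N ≤ k → a k = 0) {n : ℕ} (hn : n ≤ N) :
    moment (Function.update a N x) n =
      moment a n + (krylov a n N)ᴴ * x * krylov a n N := by
  have hb : ∀ k, (Function.update a N x k).IsHermitian := by
    intro k
    by_cases hk : k = N
    · subst hk; simpa using hx
    · simpa [Function.update_of_ne hk] using ha k
  rw [← pairing_krylov hb (M := N + 1) (by simp [hzero]) (two_mul n).symm,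
    ← pairing_krylov ha (hzero N le_rfl) (two_mul n).symm, krylov_update x hn, pairing, pairing,
    Finset.sum_range_succ, Function.update_self]
  congr 1
  refine Finset.sum_congr rfl fun k hk => ?_
  rw [Function.update_of_ne (Finset.mem_range.mp hk).ne]

/-- Solution of the truncated block Stieltjes moment problem by a finite chain. -/
theorem exists_weights_of_posDef {s : ℕ → Mat q} {m : ℕ}
    (h0 : (blockMat (fun i j => s (i + j)) m m).PosDef)
    (h1 : (blockMat (fun i j => s (i + j + 1)) m m).PosDef) (N : ℕ) (hN : N ≤ 2 * m) :
    ∃ a : ℕ → Mat q, (∀ k, (a k).IsHermitian) ∧ (∀ k < N, (a k).PosDef) ∧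
      (∀ k, N ≤ k → a k = 0) ∧ ∀ n < N, moment a n = s n := by
  induction N with
  | zero => exact ⟨fun _ => 0, by simp, by simp, by simp, by simp⟩
  | succ N ih =>
    obtain ⟨a, ha, hpos, hzero, hs⟩ := ih (by omega)
    have hdef : (s N - moment a N).PosDef := by
      obtain ⟨n, hn | hn⟩ : ∃ n, N = 2 * n + 0 ∨ N = 2 * n + 1 := ⟨N / 2, by omega⟩
      · subst hn
        exact posDef_moment_defect (by omega) (by omega) ha hpos hzero hs h0
      · subst hn
        exact posDef_moment_defect (by omega) (by omega) ha hpos hzero hs h1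
    have hu : IsUnit (krylov a N N) := isUnit_krylov_self fun k hk => (hpos k hk).isUnit
    have hdet := (Matrix.isUnit_iff_isUnit_det _).mp hu
    have hdet' : IsUnit (krylov a N N)ᴴ.det := by
      rw [← Matrix.isUnit_iff_isUnit_det]
      exact hu.star
    have hx : (((krylov a N N)⁻¹)ᴴ * (s N - moment a N) * (krylov a N N)⁻¹).PosDef :=
      hdef.conjTranspose_mul_mul_same (Matrix.mulVec_injective_of_isUnit
        ((Matrix.isUnit_nonsing_inv_iff).mpr hu))
    refine ⟨Function.update a N (((krylov a N N)⁻¹)ᴴ * (s N - moment a N) * (krylov a N N)⁻¹),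
      ?_, ?_, ?_, ?_⟩
    · intro k
      by_cases hk : k = N
      · subst hk; simpa using hx.1
      · simpa [Function.update_of_ne hk] using ha k
    · intro k hk
      by_cases hk' : k = N
      · subst hk'; simpa using hx
      · simpa [Function.update_of_ne hk'] using hpos k (by omega)
    · intro k hk
      rw [Function.update_of_ne (by omega)]
      exact hzero k (by omega)
    · intro n hn
      rw [moment_update_of_lt ha hx.1 hzero (by omega)]
      by_cases hn' : n = N
      · subst hn'
        rw [Matrix.conjTranspose_nonsing_inv]
        simp only [Matrix.mul_assoc]
        rw [Matrix.nonsing_inv_mul _ hdet, Matrix.mul_one, Matrix.mul_nonsing_inv_cancel_left _ _ hdet']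
        abel
      · rw [krylov_eq_zero_of_lt a n N (by omega), hs n (by omega)]
        simp

end StieltjesChain

section ScalarEvaluation

open Polynomial

variable {q : ℕ}

/-- Evaluation of a polynomial with matrix coefficients at a scalar. -/
def scalarEval (z : ℂ) : (Mat q)[X] →+* Mat q :=
  eval₂RingHom' (RingHom.id _) (z • (1 : Mat q)) fun a => by
    simp [Commute, SemiconjBy]

@[simp]
theorem scalarEval_C (z : ℂ) (B : Mat q) : scalarEval z (C B) = B := by
  simp [scalarEval, eval₂RingHom']

@[simp]
theorem scalarEval_X (z : ℂ) : scalarEval z (X : (Mat q)[X]) = z • 1 := by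
  simp [scalarEval, eval₂RingHom']

@[simp]
theorem scalarEval_monomial (z : ℂ) (n : ℕ) (B : Mat q) :
    scalarEval z (monomial n B) = z ^ n • B := by
  rw [← C_mul_X_pow_eq_monomial]
  simp [_root_.smul_pow]

theorem scalarEval_eq_sum (z : ℂ) {p : (Mat q)[X]} {N : ℕ} (h : ∀ n, N ≤ n → p.coeff n = 0) :
    scalarEval z p = ∑ k ∈ Finset.range N, z ^ k • p.coeff k := by
  have hp : p = ∑ k ∈ Finset.range N, monomial k (p.coeff k) := by
    ext1 n
    simp only [finsetSum_coeff, coeff_monomial, Finset.sum_ite_eq', Finset.mem_range]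
    split_ifs with hn
    · rfl
    · exact h n (by omega)
  conv_lhs => rw [hp]
  simp

theorem exists_entry_polynomial (p : (Mat q)[X]) (a b : Fin q) :
    ∃ r : ℂ[X], (∀ z, scalarEval z p a b = r.eval z) ∧ ∀ n, r.coeff n = p.coeff n a b := by
  have hc : ∀ n, p.natDegree + 1 ≤ n → p.coeff n = 0 := fun n hn =>
    coeff_eq_zero_of_natDegree_lt (by omega)
  refine ⟨∑ k ∈ Finset.range (p.natDegree + 1), monomial k (p.coeff k a b), ?_, ?_⟩
  · intro z
    rw [scalarEval_eq_sum z hc]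
    simp [Matrix.sum_apply, eval_finsetSum, mul_comm]
  · intro n
    simp only [finsetSum_coeff, coeff_monomial, Finset.sum_ite_eq', Finset.mem_range]
    split_ifs with hn
    · rfl
    · rw [hc n (by omega), Matrix.zero_apply]

theorem eq_zero_of_tendsto_scalarEval {p : (Mat q)[X]}
    (h : Filter.Tendsto (fun x : ℝ => scalarEval (x : ℂ) p) Filter.atTop (nhds 0)) : p = 0 := by
  ext n a b
  obtain ⟨r, hr, hrc⟩ := exists_entry_polynomial p a b
  rw [← hrc, coeff_zero, Matrix.zero_apply]
  have hlim : Filter.Tendsto (fun x : ℝ => r.eval (x : ℂ)) Filter.atTop (nhds 0) := by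
    have h0 := ((continuous_apply_apply a b).tendsto (0 : Mat q)).comp h
    rw [Matrix.zero_apply] at h0
    exact h0.congr fun x => hr x
  have hdeg : r.degree ≤ 0 := by
    by_contra! hd
    have := r.tendsto_norm_atTop hd (l := Filter.atTop) (z := fun x : ℝ => (x : ℂ))
      (by simpa using Filter.tendsto_abs_atTop_atTop)
    exact not_tendsto_nhds_of_tendsto_atTop this _ hlim.norm
  rw [eq_C_of_degree_le_zero hdeg] at hlim ⊢
  simp only [eval_C] at hlim
  rw [tendsto_nhds_unique tendsto_const_nhds hlim]
  simp

theorem eq_of_scalarEval_eq {p r : (Mat q)[X]} (h : ∀ z, scalarEval z p = scalarEval z r) :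
    p = r := by
  rw [← sub_eq_zero]
  apply eq_zero_of_tendsto_scalarEval
  simp [h]

theorem tendsto_inv_pow_smul_scalarEval {p : (Mat q)[X]} {m : ℕ}
    (h : ∀ n, m < n → p.coeff n = 0) :
    Filter.Tendsto (fun x : ℝ => ((x : ℂ) ^ m)⁻¹ • scalarEval (x : ℂ) p) Filter.atTop
      (nhds (p.coeff m)) := by
  have hlow : ∀ k ∈ Finset.range m, Filter.Tendsto
      (fun x : ℝ => (((x : ℂ) ^ m)⁻¹ * (x : ℂ) ^ k) • p.coeff k) Filter.atTop (nhds 0) := by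
    intro k hk
    have hk' := Finset.mem_range.mp hk
    have h1 : Filter.Tendsto (fun x : ℝ => ((x : ℂ) ^ m)⁻¹ * (x : ℂ) ^ k) Filter.atTop
        (nhds 0) := by
      have h2 : Filter.Tendsto (fun x : ℝ => ((x ^ (m - k))⁻¹ : ℝ)) Filter.atTop (nhds 0) :=
        (Filter.tendsto_pow_atTop (by omega)).inv_tendsto_atTop
      have h3 := (Complex.continuous_ofReal.tendsto 0).comp h2
      rw [Complex.ofReal_zero] at h3
      refine h3.congr' ?_
      filter_upwards [Filter.eventually_gt_atTop 0] with x hx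
      have hx' : (x : ℂ) ≠ 0 := by exact_mod_cast hx.ne'
      have hm : (x : ℂ) ^ m = (x : ℂ) ^ (m - k) * (x : ℂ) ^ k := by
        rw [← pow_add]; congr 1; omega
      rw [hm]
      simp only [Function.comp_apply]
      push_cast
      field_simp
    simpa using h1.smul_const (p.coeff k)
  have hsum := tendsto_finsetSum _ hlow
  rw [Finset.sum_const_zero] at hsum
  have htop : Filter.Tendsto (fun x : ℝ => (((x : ℂ) ^ m)⁻¹ * (x : ℂ) ^ m) • p.coeff m)
      Filter.atTop (nhds (p.coeff m)) := by
    refine tendsto_const_nhds.congr' ?_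
    filter_upwards [Filter.eventually_gt_atTop 0] with x hx
    have hx' : (x : ℂ) ≠ 0 := by exact_mod_cast hx.ne'
    rw [inv_mul_cancel₀ (pow_ne_zero _ hx'), one_smul]
  have hadd := hsum.add htop
  rw [zero_add] at hadd
  refine hadd.congr fun x => ?_
  rw [scalarEval_eq_sum (x : ℂ) (N := m + 1) fun n hn => h n hn, Finset.sum_range_succ, smul_add,
    Finset.smul_sum]
  simp [smul_smul]

theorem eventually_det_scalarEval_ne_zero {H : (Mat q)[X]} {m : ℕ} (hlead : H.coeff m = 1)
    (hH : ∀ n, m < n → H.coeff n = 0) :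
    ∀ᶠ x : ℝ in Filter.atTop, (scalarEval (x : ℂ) H).det ≠ 0 := by
  have h1 := tendsto_inv_pow_smul_scalarEval hH
  rw [hlead] at h1
  have h2 := ((continuous_id.matrix_det).tendsto (1 : Mat q)).comp h1
  simp only [id, Matrix.det_one] at h2
  filter_upwards [h2.eventually_ne one_ne_zero] with x hx h0
  apply hx
  simp [h0]

theorem tendsto_scalarEval_mul_inv {R H : (Mat q)[X]} {m : ℕ} (hlead : H.coeff m = 1)
    (hH : ∀ n, m < n → H.coeff n = 0) (hR : ∀ n, m ≤ n → R.coeff n = 0) :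
    Filter.Tendsto (fun x : ℝ => scalarEval (x : ℂ) R * (scalarEval (x : ℂ) H)⁻¹) Filter.atTop
      (nhds 0) := by
  have h1 := tendsto_inv_pow_smul_scalarEval hH
  have h2 := tendsto_inv_pow_smul_scalarEval fun n hn => hR n (le_of_lt hn)
  rw [hlead] at h1
  rw [hR m le_rfl] at h2
  have h3 : Filter.Tendsto (fun x : ℝ => (((x : ℂ) ^ m)⁻¹ • scalarEval (x : ℂ) H)⁻¹)
      Filter.atTop (nhds (1 : Mat q)⁻¹) := by
    refine Filter.Tendsto.comp (continuousAt_matrix_inv (1 : Mat q) ?_) h1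
    simp [Ring.inverse_eq_inv']
  have h4 := h2.mul h3
  rw [zero_mul] at h4
  refine h4.congr' ?_
  filter_upwards [Filter.eventually_gt_atTop 0, eventually_det_scalarEval_ne_zero hlead hH] with x hx hdet
  have hx' : ((x : ℂ) ^ m)⁻¹ ≠ 0 := inv_ne_zero (pow_ne_zero _ (by exact_mod_cast hx.ne'))
  have hinv : (((x : ℂ) ^ m)⁻¹ • scalarEval (x : ℂ) H)⁻¹ =
      (((x : ℂ) ^ m)⁻¹)⁻¹ • (scalarEval (x : ℂ) H)⁻¹ := by
    apply Matrix.inv_eq_left_inv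
    rw [smul_mul_smul_comm, inv_mul_cancel₀ hx', Matrix.nonsing_inv_mul _ hdet.isUnit, one_smul]
  rw [hinv, smul_mul_smul_comm, mul_inv_cancel₀ hx', one_smul]

end ScalarEvaluation

section ContinuedFraction

open Polynomial

variable {q : ℕ}

/-- Numerator and negated denominator of the tails of the continued fraction `wEven`: the ratio
`-(tailPair c d m (t + 1)).2 / (tailPair c d m (t + 1)).1` evaluates to `wEven q m c d t`. -/
def tailPair (c d : ℕ → Mat q) (m : ℕ) : ℕ → (Mat q)[X] × (Mat q)[X]
  | 0 => (0, 1)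
  | t + 1 =>
    let x := C (d (m - 1 - t)) * (tailPair c d m t).2 - (tailPair c d m t).1
    (x, -(X * (C (c (m - 1 - t)) * x)) - (tailPair c d m t).2)

theorem tailPair_succ_fst (c d : ℕ → Mat q) (m t : ℕ) :
    (tailPair c d m (t + 1)).1 =
      C (d (m - 1 - t)) * (tailPair c d m t).2 - (tailPair c d m t).1 := rfl

theorem tailPair_succ_snd (c d : ℕ → Mat q) (m t : ℕ) :
    (tailPair c d m (t + 1)).2 =
      -(X * (C (c (m - 1 - t)) * (tailPair c d m (t + 1)).1)) - (tailPair c d m t).2 := rfl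

theorem coeff_tailPair (c d : ℕ → Mat q) (m t : ℕ) :
    (∀ n, t ≤ n → (tailPair c d m t).1.coeff n = 0) ∧
      ∀ n, t < n → (tailPair c d m t).2.coeff n = 0 := by
  induction t with
  | zero =>
    refine ⟨fun n _ => by simp [tailPair], fun n hn => ?_⟩
    simp [tailPair, coeff_one, hn.ne']
  | succ t ih =>
    have hx : ∀ n, t + 1 ≤ n → (tailPair c d m (t + 1)).1.coeff n = 0 := by
      intro n hn
      rw [tailPair_succ_fst, coeff_sub, coeff_C_mul, ih.1 n (by omega), ih.2 n (by omega)]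
      simp
    refine ⟨hx, fun n hn => ?_⟩
    obtain ⟨k, rfl⟩ : ∃ k, n = k + 1 := ⟨n - 1, by omega⟩
    rw [tailPair_succ_snd, coeff_sub, coeff_neg, coeff_X_mul, coeff_C_mul, hx k (by omega),
      ih.2 _ (by omega)]
    simp

theorem isUnit_coeff_tailPair {c d : ℕ → Mat q} {m t : ℕ} (hc : ∀ k < m, IsUnit (c k))
    (hd : ∀ k < m, IsUnit (d k)) (ht : t ≤ m) : IsUnit ((tailPair c d m t).2.coeff t) := by
  induction t with
  | zero => simp [tailPair]
  | succ t ih =>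
    have h := coeff_tailPair c d m t
    rw [tailPair_succ_snd, coeff_sub, coeff_neg, coeff_X_mul, coeff_C_mul, tailPair_succ_fst,
      coeff_sub, coeff_C_mul, h.1 t le_rfl, h.2 _ (Nat.lt_succ_self t), sub_zero, sub_zero]
    exact ((hc _ (by omega)).mul ((hd _ (by omega)).mul (ih (by omega)))).neg

theorem wEven_mul_scalarEval_tailPair {c d : ℕ → Mat q} {m t : ℕ} {z : ℂ} (ht : t < m)
    (hd : ∀ k < m, IsUnit (d k))
    (hw : ∀ j < m, IsUnit (wEven q m c d j z).det)
    (hdw : ∀ j, j + 1 < m → IsUnit (d (m - 2 - j) + (wEven q m c d j z)⁻¹).det) :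
    IsUnit (scalarEval z (tailPair c d m (t + 1)).1) ∧
      wEven q m c d t z * scalarEval z (tailPair c d m (t + 1)).1 =
        -scalarEval z (tailPair c d m (t + 1)).2 := by
  induction t with
  | zero =>
    have hunit := hd (m - 1) (by omega)
    refine ⟨by simpa [tailPair] using hunit, ?_⟩
    have hinv := Matrix.nonsing_inv_mul _ ((Matrix.isUnit_iff_isUnit_det _).mp hunit)
    simp [tailPair, wEven, add_mul, hinv, add_comm]
  | succ t ih =>
    obtain ⟨hx, heq⟩ := ih (by omega)
    have hwt := hw t (by omega)
    set w := wEven q m c d t z with hwdef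
    set x := scalarEval z (tailPair c d m (t + 1)).1 with hxdef
    set y := scalarEval z (tailPair c d m (t + 1)).2 with hydef
    have hsub : m - 1 - (t + 1) = m - 2 - t := by omega
    have hy : IsUnit y := by
      rw [← neg_neg y, ← heq]
      exact (((Matrix.isUnit_iff_isUnit_det _).mpr hwt).mul hx).neg
    have hxw : x = -(w⁻¹ * y) := by
      rw [← mul_neg, ← heq, ← mul_assoc, Matrix.nonsing_inv_mul _ hwt, one_mul]
    have hnew : scalarEval z (tailPair c d m (t + 1 + 1)).1 = (d (m - 2 - t) + w⁻¹) * y := by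
      rw [tailPair_succ_fst, map_sub, map_mul, scalarEval_C, hsub, ← hxdef, ← hydef, hxw, add_mul]
      abel
    have hdwt := hdw t (by omega)
    refine ⟨hnew ▸ ((Matrix.isUnit_iff_isUnit_det _).mpr hdwt).mul hy, ?_⟩
    have hz : scalarEval z (tailPair c d m (t + 1 + 1)).2 =
        -(z • c (m - 2 - t) * scalarEval z (tailPair c d m (t + 1 + 1)).1) - y := by
      rw [tailPair_succ_snd, map_sub, map_neg, map_mul, map_mul, scalarEval_C, scalarEval_X, hsub]
      simp [hydef]
    rw [hz, hnew]
    simp only [wEven]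
    rw [← hwdef, add_mul, ← mul_assoc (d (m - 2 - t) + w⁻¹)⁻¹, Matrix.nonsing_inv_mul _ hdwt]
    simp [add_comm]

end ContinuedFraction

section TailRecursion

open Polynomial

variable {q : ℕ}

theorem sum_range_mul_of_eq_add_prev {R : Type*} [Ring R] {u v x : ℕ → R} (h0 : v 0 = u 0)
    (h : ∀ k, v (k + 1) = u k + u (k + 1)) (M : ℕ) :
    ∑ k ∈ Finset.range (M + 1), v k * x k + u M * x (M + 1) =
      ∑ k ∈ Finset.range (M + 1), u k * (x k + x (k + 1)) := by
  induction M with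
  | zero => simp [h0, mul_add]
  | succ M ih =>
    rw [Finset.sum_range_succ, Finset.sum_range_succ _ (M + 1), ← ih, h, add_mul, mul_add]
    abel

theorem sum_range_mul_of_eq_add_next {R : Type*} [Ring R] {o b y : ℕ → R}
    (h : ∀ k, o k = b k + b (k + 1)) (M : ℕ) :
    ∑ k ∈ Finset.range M, o k * y (k + 1) =
      ∑ k ∈ Finset.range M, b k * (y k + y (k + 1)) - b 0 * y 0 + b M * y M := by
  induction M with
  | zero => simp
  | succ M ih =>
    rw [Finset.sum_range_succ, Finset.sum_range_succ, ih, h, add_mul, mul_add]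
    abel

theorem C_mul_neg_X_mul {R : Type*} [Ring R] {b c e : R} (h : b * c = e) (p : R[X]) :
    C b * -(X * (C c * p)) = -(X * (C e * p)) := by
  rw [mul_neg, ← mul_assoc, ← X_mul_C, mul_assoc, ← mul_assoc (C b), ← C_mul, h]

/-- The combination of the tails of the continued fraction obtained by applying `2 * n` steps of
`hop` to the first one. -/
def tailComb (a c d : ℕ → Mat q) (m n : ℕ) : (Mat q)[X] :=
  ∑ k ∈ Finset.range m, C (krylov a (2 * n) (2 * k))ᴴ * (tailPair c d m (m - k)).1

theorem tailComb_zero (a c d : ℕ → Mat q) {m : ℕ} (hm : 0 < m) :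
    tailComb a c d m 0 = (tailPair c d m m).1 := by
  rw [tailComb, Finset.sum_eq_single_of_mem 0 (by simpa using hm)]
  · simp [krylov]
  · intro k _ hk
    simp [krylov, hk]

theorem coeff_tailComb (a c d : ℕ → Mat q) (m n : ℕ) {i : ℕ} (hi : m ≤ i) :
    (tailComb a c d m n).coeff i = 0 := by
  rw [tailComb, finsetSum_coeff]
  refine Finset.sum_eq_zero fun k _ => ?_
  rw [coeff_C_mul, (coeff_tailPair c d m (m - k)).1 i (by omega), mul_zero]

theorem tailComb_succ {a c d : ℕ → Mat q} {m : ℕ} (hm : 0 < m) (ha : ∀ k, (a k).IsHermitian)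
    (hM : a (2 * m) = 0) (hc : ∀ k < m, a (2 * k) * c k = 1)
    (hd : ∀ k < m, a (2 * k + 1) * d k = 1) (n : ℕ) :
    tailComb a c d m (n + 1) =
      -(X * tailComb a c d m n) - C (moment a n) * (tailPair c d m m).2 := by
  obtain ⟨M, rfl⟩ : ∃ M, m = M + 1 := ⟨m - 1, by omega⟩
  set x : ℕ → (Mat q)[X] := fun k => (tailPair c d (M + 1) (M + 1 - k)).1 with hx
  set y : ℕ → (Mat q)[X] := fun k => (tailPair c d (M + 1) (M + 1 - k)).2 with hy
  have hstep : ∀ k < M + 1, x k + x (k + 1) = C (d k) * y (k + 1) ∧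
      y k + y (k + 1) = -(X * (C (c k) * x k)) := by
    intro k hk
    have h1 : M + 1 - k = (M + 1 - (k + 1)) + 1 := by omega
    have h2 : M + 1 - 1 - (M + 1 - (k + 1)) = k := by omega
    have hy' : y k = -(X * (C (c k) * x k)) - y (k + 1) := by
      simp only [hy, hx]
      rw [h1, tailPair_succ_snd, h2]
    refine ⟨?_, by rw [hy']; abel⟩
    simp only [hx, hy]
    rw [h1, tailPair_succ_fst, h2]
    abel
  have hxM : x (M + 1) = 0 := by simp [hx, tailPair]
  set o : ℕ → (Mat q)[X] := fun k => C (krylov a (2 * n + 1) (2 * k + 1))ᴴ with ho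
  set b : ℕ → (Mat q)[X] := fun k => C (a (2 * k) * krylov a (2 * n) (2 * k))ᴴ with hb
  set u : ℕ → (Mat q)[X] := fun k => C (a (2 * k + 1) * krylov a (2 * n + 1) (2 * k + 1))ᴴ with hu
  have hA := sum_range_mul_of_eq_add_prev (x := x) (u := u)
    (v := fun k => C (krylov a (2 * (n + 1)) (2 * k))ᴴ) rfl (fun k => by
      simp only [hu]
      rw [← C_add, ← Matrix.conjTranspose_add]
      rfl) M
  have hB := sum_range_mul_of_eq_add_next (y := y) (o := o) (b := b) (fun k => by
      simp only [hb, ho]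
      rw [← C_add, ← Matrix.conjTranspose_add]
      rfl) (M + 1)
  have hbM : b (M + 1) = 0 := by simp [hb, hM]
  have hb0 : b 0 = C (moment a n) := by
    simp only [hb]
    rw [← (isHermitian_moment ha hM n).eq]
    rfl
  rw [hxM, mul_zero, add_zero] at hA
  rw [hbM, zero_mul, add_zero, hb0] at hB
  have h1 : ∑ k ∈ Finset.range (M + 1), u k * (x k + x (k + 1)) =
      ∑ k ∈ Finset.range (M + 1), o k * y (k + 1) := by
    refine Finset.sum_congr rfl fun k hk => ?_
    have hk' := Finset.mem_range.mp hk
    rw [(hstep k hk').1, ← mul_assoc, hu, ho]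
    simp only
    rw [← C_mul, Matrix.conjTranspose_mul, (ha _).eq, mul_assoc, hd k hk', mul_one]
  have h2 : ∑ k ∈ Finset.range (M + 1), b k * (y k + y (k + 1)) =
      -(X * tailComb a c d (M + 1) n) := by
    rw [tailComb, Finset.mul_sum, ← Finset.sum_neg_distrib]
    refine Finset.sum_congr rfl fun k hk => ?_
    have hk' := Finset.mem_range.mp hk
    rw [(hstep k hk').2]
    simp only [hb, hx]
    refine C_mul_neg_X_mul ?_ _
    rw [Matrix.conjTranspose_mul, (ha _).eq, mul_assoc, hc k hk', mul_one]
  rw [tailComb, hA, h1, hB, h2]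
  simp [hy]

end TailRecursion

section MarkovPair

open Polynomial

variable {q : ℕ}

/-- The polynomial `∑_{j < N} (-1) ^ (N - 1 - j) s_j z ^ (N - 1 - j)`. -/
def momentPoly (s : ℕ → Mat q) : ℕ → (Mat q)[X]
  | 0 => 0
  | N + 1 => C (s N) - X * momentPoly s N

theorem coeff_momentPoly (s : ℕ → Mat q) (N t : ℕ) :
    (momentPoly s N).coeff t = if t < N then (-1 : ℂ) ^ t • s (N - 1 - t) else 0 := by
  induction N generalizing t with
  | zero => simp [momentPoly]
  | succ N ih =>
    obtain _ | t := t
    · simp [momentPoly]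
    · simp only [momentPoly, coeff_sub, coeff_C_succ, coeff_X_mul, ih, Nat.succ_lt_succ_iff]
      split_ifs
      · rw [show N + 1 - 1 - (t + 1) = N - 1 - t by omega, pow_succ]
        simp
      · simp

theorem momentPoly_congr {s s' : ℕ → Mat q} {N : ℕ} (h : ∀ n < N, s n = s' n) :
    momentPoly s N = momentPoly s' N := by
  induction N with
  | zero => rfl
  | succ N ih =>
    rw [momentPoly, momentPoly, h N (Nat.lt_succ_self N), ih fun n hn => h n (by omega)]

theorem momentPoly_injOn {s s' : ℕ → Mat q} {N : ℕ} (h : momentPoly s N = momentPoly s' N)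
    {n : ℕ} (hn : n < N) : s n = s' n := by
  have h1 := congrArg (fun p => p.coeff (N - 1 - n)) h
  simp only [coeff_momentPoly] at h1
  rw [if_pos (by omega), if_pos (by omega), show N - 1 - (N - 1 - n) = n by omega] at h1
  exact smul_right_injective _ (pow_ne_zero _ (neg_ne_zero.mpr one_ne_zero)) h1

/-- `G H⁻¹` is a proper rational function with monic denominator of degree `m`, whose first `2 * m`
Markov parameters are `s`. -/
structure IsMarkovPair (m : ℕ) (s : ℕ → Mat q) (G H : (Mat q)[X]) : Prop where
  coeff_num : ∀ n, m ≤ n → G.coeff n = 0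
  leadingCoeff_den : H.coeff m = 1
  coeff_den : ∀ n, m < n → H.coeff n = 0
  coeff_defect : ∀ n, m ≤ n → (X ^ (2 * m) * G + momentPoly s (2 * m) * H).coeff n = 0

namespace IsMarkovPair

variable {m : ℕ} {s : ℕ → Mat q} {G H : (Mat q)[X]}

theorem congr {s' : ℕ → Mat q} (h : IsMarkovPair m s G H) (hs : ∀ n < 2 * m, s n = s' n) :
    IsMarkovPair m s' G H :=
  ⟨h.1, h.2, h.3, momentPoly_congr hs ▸ h.4⟩

theorem coeff_mul_den (h : IsMarkovPair m s G H) (S : (Mat q)[X]) (n : ℕ) :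
    (S * H).coeff n =
      ∑ k ∈ Finset.range (m + 1), if k ≤ n then S.coeff (n - k) * H.coeff k else 0 := by
  rw [coeff_mul, Finset.Nat.sum_antidiagonal_eq_sum_range_succ_mk, ← Finset.sum_range_reflect,
    ← Finset.sum_filter]
  symm
  apply Finset.sum_subset_zero_on_sdiff
  · intro k hk
    simp only [Finset.mem_filter, Finset.mem_range] at hk ⊢
    omega
  · intro k hk
    simp only [Finset.mem_sdiff, Finset.mem_filter, Finset.mem_range] at hk ⊢
    rw [h.coeff_den _ (by omega), mul_zero]
  · intro k hk
    simp only [Finset.mem_filter, Finset.mem_range] at hk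
    simp only
    congr 2
    omega

theorem sum_hankel_eq_zero (h : IsMarkovPair m s G H) {i : ℕ} (hi : i < m) :
    ∑ k ∈ Finset.range (m + 1), (-1 : ℂ) ^ k • (s (i + k) * H.coeff k) = 0 := by
  have h1 := h.coeff_defect (2 * m - 1 - i) (by omega)
  rw [coeff_add, coeff_X_pow_mul', if_neg (by omega), zero_add, h.coeff_mul_den] at h1
  have h2 := congrArg (fun B => (-1 : ℂ) ^ (2 * m - 1 - i) • B) h1
  simp only [smul_zero, Finset.smul_sum] at h2
  rw [← h2]
  refine Finset.sum_congr rfl fun k hk => ?_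
  have hk' := Finset.mem_range.mp hk
  rw [if_pos (by omega), coeff_momentPoly, if_pos (by omega),
    show 2 * m - 1 - (2 * m - 1 - i - k) = i + k by omega, smul_mul_assoc, smul_smul, ← pow_add,
    show 2 * m - 1 - i + (2 * m - 1 - i - k) = 2 * (2 * m - 1 - i - k) + k by omega, pow_add,
    pow_mul]
  simp

theorem coeff_num_eq (h : IsMarkovPair m s G H) (n : ℕ) :
    G.coeff n = ∑ k ∈ Finset.range (m + 1),
      if n < k then (-1 : ℂ) ^ (n + k + 1) • (s (k - 1 - n) * H.coeff k) else 0 := by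
  have h1 := h.coeff_defect (n + 2 * m) (by omega)
  rw [coeff_add, coeff_X_pow_mul, h.coeff_mul_den] at h1
  rw [eq_neg_of_add_eq_zero_left h1, ← Finset.sum_neg_distrib]
  refine Finset.sum_congr rfl fun k hk => ?_
  have hk' := Finset.mem_range.mp hk
  rw [if_pos (by omega), coeff_momentPoly]
  by_cases hnk : n < k
  · rw [if_pos (by omega), if_pos hnk, show 2 * m - 1 - (n + 2 * m - k) = k - 1 - n by omega,
      smul_mul_assoc, ← neg_smul]
    congr 1
    have h2 : (-1 : ℂ) ^ (n + 2 * m - k) * (-1) ^ k = (-1) ^ n := by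
      rw [← pow_add, show n + 2 * m - k + k = n + 2 * m by omega, pow_add, pow_mul]
      simp
    have h3 : (-1 : ℂ) ^ k * (-1) ^ k = 1 := by rw [← mul_pow]; simp
    rw [pow_succ, pow_add, ← h2]
    linear_combination (-(-1 : ℂ) ^ (n + 2 * m - k)) * h3.symm
  · rw [if_neg (by omega), if_neg hnk]
    simp

theorem hankel_mul_blockCol (h : IsMarkovPair m s G H) :
    H1b q s m * blockCol (fun k => (-1 : ℂ) ^ (m + k + 1) • H.coeff k) m = Y1b q s m := by
  change blockMat (fun i j => s (i + j)) m m * _ = blockCol (fun i => s (m + i)) m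
  rw [blockMat_mul_blockCol, blockCol_eq_iff]
  intro i hi
  have h1 := h.sum_hankel_eq_zero hi
  rw [Finset.sum_range_succ, h.leadingCoeff_den, mul_one] at h1
  have h2 : ∑ k ∈ Finset.range m, s (i + k) * (-1 : ℂ) ^ (m + k + 1) • H.coeff k =
      (-1 : ℂ) ^ (m + 1) • ∑ k ∈ Finset.range m, (-1 : ℂ) ^ k • (s (i + k) * H.coeff k) := by
    rw [Finset.smul_sum]
    refine Finset.sum_congr rfl fun k _ => ?_
    rw [mul_smul_comm, smul_smul]
    congr 1
    ring
  have h3 : (-1 : ℂ) ^ m * (-1) ^ m = 1 := by rw [← mul_pow]; simp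
  rw [h2, eq_neg_of_add_eq_zero_left h1, smul_neg, smul_smul, ← neg_smul, add_comm m i]
  convert one_smul ℂ (s (i + m)) using 2
  rw [pow_succ]
  linear_combination h3

theorem hankel_inv_mul (h : IsMarkovPair m s G H) (hs : IsUnit (H1b q s m)) :
    (H1b q s m)⁻¹ * Y1b q s m = blockCol (fun k => (-1 : ℂ) ^ (m + k + 1) • H.coeff k) m := by
  rw [← h.hankel_mul_blockCol, ← Matrix.mul_assoc,
    Matrix.nonsing_inv_mul _ ((Matrix.isUnit_iff_isUnit_det _).mp hs), Matrix.one_mul]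

theorem unique {G' H' : (Mat q)[X]} (h : IsMarkovPair m s G H) (h' : IsMarkovPair m s G' H')
    (hs : IsUnit (H1b q s m)) : G = G' ∧ H = H' := by
  have hH : ∀ k, H.coeff k = H'.coeff k := by
    intro k
    rcases lt_trichotomy k m with hk | rfl | hk
    · have h1 := (h.hankel_inv_mul hs).symm.trans (h'.hankel_inv_mul hs)
      exact smul_right_injective _ (pow_ne_zero _ (neg_ne_zero.mpr one_ne_zero))
        (blockCol_eq_iff.mp h1 k hk)
    · rw [h.leadingCoeff_den, h'.leadingCoeff_den]
    · rw [h.coeff_den k hk, h'.coeff_den k hk]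
  refine ⟨?_, Polynomial.ext hH⟩
  ext1 n
  rw [h.coeff_num_eq, h'.coeff_num_eq]
  simp only [hH]

theorem eq_of_mul_inv_eq {s' : ℕ → Mat q} {G' H' : (Mat q)[X]} (h : IsMarkovPair m s G H)
    (h' : IsMarkovPair m s' G' H')
    (heq : ∀ᶠ x : ℝ in Filter.atTop, scalarEval (x : ℂ) G * (scalarEval (x : ℂ) H)⁻¹ =
      scalarEval (x : ℂ) G' * (scalarEval (x : ℂ) H')⁻¹) {n : ℕ} (hn : n < 2 * m) :
    s n = s' n := by
  refine momentPoly_injOn (N := 2 * m) ?_ hn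
  rw [← sub_eq_zero]
  apply eq_zero_of_tendsto_scalarEval
  have h1 := tendsto_scalarEval_mul_inv h.leadingCoeff_den h.coeff_den h.coeff_defect
  have h2 := tendsto_scalarEval_mul_inv h'.leadingCoeff_den h'.coeff_den h'.coeff_defect
  have h3 := h1.sub h2
  rw [sub_zero] at h3
  refine h3.congr' ?_
  filter_upwards [heq, eventually_det_scalarEval_ne_zero h.leadingCoeff_den h.coeff_den,
    eventually_det_scalarEval_ne_zero h'.leadingCoeff_den h'.coeff_den] with x hx hd hd'
  simp only [map_add, map_mul, map_sub, add_mul]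
  rw [mul_assoc _ (scalarEval (x : ℂ) G), mul_assoc _ (scalarEval (x : ℂ) G'), hx,
    mul_assoc _ (scalarEval (x : ℂ) H), mul_assoc _ (scalarEval (x : ℂ) H'),
    Matrix.mul_nonsing_inv _ hd.isUnit, Matrix.mul_nonsing_inv _ hd'.isUnit]
  simp

theorem scalarEval_den (h : IsMarkovPair m s G H) (hs : (H1b q s m).PosDef) (z : ℂ) :
    scalarEval z H = (-1 : ℂ) ^ m • (P1 q s m ((starRingEnd ℂ) (-z)))ᴴ := by
  have hcol : colPow q m ((starRingEnd ℂ) (-z)) =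
      blockCol (fun k => ((starRingEnd ℂ) (-z)) ^ k • (1 : Mat q)) m := by
    ext ⟨i, a⟩ b
    simp [colPow, blockCol, Matrix.one_apply]
  have h3 : (-1 : ℂ) ^ m * (-1) ^ m = 1 := by rw [← mul_pow]; simp
  rw [P1, Matrix.conjTranspose_sub, Matrix.conjTranspose_mul, Matrix.conjTranspose_mul,
    Matrix.conjTranspose_conjTranspose, hs.1.inv.eq, h.hankel_inv_mul hs.isUnit, hcol,
    conjTranspose_blockCol_mul_blockCol, scalarEval_eq_sum z (N := m + 1) h.coeff_den,
    Finset.sum_range_succ, h.leadingCoeff_den, smul_sub, sub_eq_add_neg, add_comm,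
    Finset.smul_sum, ← Finset.sum_neg_distrib]
  congr 1
  · simp only [Matrix.conjTranspose_smul, Matrix.conjTranspose_one, smul_smul, star_pow]
    simp [neg_pow z, ← mul_assoc, h3]
  · refine Finset.sum_congr rfl fun k _ => ?_
    simp only [Matrix.conjTranspose_smul, Matrix.conjTranspose_one, smul_mul_assoc, one_mul,
      smul_smul, star_pow, ← neg_smul]
    congr 1
    have h4 : (-1 : ℂ) ^ k * (-1) ^ k = 1 := by rw [← mul_pow]; simp
    simp only [RCLike.star_def, Complex.conj_conj]
    rw [neg_pow z, pow_succ, pow_add]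
    linear_combination (-z ^ k) * ((-1 : ℂ) ^ k * (-1) ^ k * h3 + h4)

theorem conjTranspose_rPol {i : ℕ} (hs : ∀ k < i, (s k).IsHermitian) (w : ℂ) :
    (rPol q s i ((starRingEnd ℂ) w))ᴴ = rPol q s i w := by
  rw [rPol, rPol, Matrix.conjTranspose_sum]
  refine Finset.sum_congr rfl fun k hk => ?_
  rw [Matrix.conjTranspose_smul, (hs k (Finset.mem_range.mp hk)).eq]
  simp

theorem scalarEval_num_eq_sum (h : IsMarkovPair m s G H) (z : ℂ) :
    scalarEval z G =
      ∑ k ∈ Finset.range (m + 1), (-1 : ℂ) ^ (k + 1) • (rPol q s k (-z) * H.coeff k) := by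
  rw [scalarEval_eq_sum z h.coeff_num]
  simp only [h.coeff_num_eq, Finset.smul_sum]
  rw [Finset.sum_comm]
  refine Finset.sum_congr rfl fun k hk => ?_
  have hk' := Finset.mem_range.mp hk
  rw [rPol, ← Finset.sum_range_reflect _ k, Finset.sum_mul, Finset.smul_sum]
  simp only [smul_ite, smul_zero]
  rw [← Finset.sum_filter]
  refine Finset.sum_congr ?_ fun n hn => ?_
  · ext n
    simp only [Finset.mem_filter, Finset.mem_range]
    omega
  · have hn' := Finset.mem_range.mp hn
    rw [show k - 1 - (k - 1 - n) = n by omega, smul_mul_assoc, smul_smul, smul_smul]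
    congr 1
    rw [neg_pow z]
    ring

theorem scalarEval_num (h : IsMarkovPair m s G H) (hs : (H1b q s m).PosDef)
    (hherm : ∀ j < 2 * m, (s j).IsHermitian) (z : ℂ) :
    scalarEval z G = (-1 : ℂ) ^ (m + 1) • (Q1 q s m ((starRingEnd ℂ) (-z)))ᴴ := by
  have hcol : colR q s m ((starRingEnd ℂ) (-z)) =
      blockCol (fun k => rPol q s k ((starRingEnd ℂ) (-z))) m := rfl
  have h3 : (-1 : ℂ) ^ m * (-1) ^ m = 1 := by rw [← mul_pow]; simp
  rw [Q1, Matrix.conjTranspose_sub, Matrix.conjTranspose_mul, Matrix.conjTranspose_mul,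
    Matrix.conjTranspose_conjTranspose, hs.1.inv.eq, h.hankel_inv_mul hs.isUnit, hcol,
    conjTranspose_blockCol_mul_blockCol, h.scalarEval_num_eq_sum,
    Finset.sum_range_succ, h.leadingCoeff_den, smul_sub, sub_eq_add_neg, add_comm,
    Finset.smul_sum, ← Finset.sum_neg_distrib, mul_one,
    conjTranspose_rPol fun k hk => hherm k (by omega)]
  congr 1
  refine Finset.sum_congr rfl fun k hk => ?_
  have hk' := Finset.mem_range.mp hk
  rw [conjTranspose_rPol fun k hk => hherm k (by omega), mul_smul_comm, smul_smul, ← neg_smul]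
  congr 1
  rw [pow_succ, pow_succ, pow_succ, pow_add]
  linear_combination (-1 : ℂ) ^ k * h3

end IsMarkovPair

end MarkovPair

section Main

open Polynomial

variable {q : ℕ}

/-- The h-part of `A` as a polynomial. -/
def hPoly (m : ℕ) (A : ℕ → Mat q) : (Mat q)[X] :=
  ∑ j ∈ Finset.range (m + 1), monomial (m - j) (A (2 * j))

/-- The g-part of `A` as a polynomial. -/
def gPoly (m : ℕ) (A : ℕ → Mat q) : (Mat q)[X] :=
  ∑ j ∈ Finset.range m, monomial (m - 1 - j) (A (2 * j + 1))

theorem scalarEval_hPoly (m : ℕ) (A : ℕ → Mat q) (z : ℂ) :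
    scalarEval z (hPoly m A) = hEven q m A z := by
  simp [hPoly, hEven]

theorem scalarEval_gPoly (m : ℕ) (A : ℕ → Mat q) (z : ℂ) :
    scalarEval z (gPoly m A) = gEven q m A z := by
  simp [gPoly, gEven]

theorem scalarEval_momentPoly (m : ℕ) (s : ℕ → Mat q) (z : ℂ) :
    scalarEval z (momentPoly s (2 * m)) =
      -∑ j ∈ Finset.range (2 * m), ((-1 : ℂ) ^ j * z ^ (2 * m - 1 - j)) • s j := by
  rw [scalarEval_eq_sum z (N := 2 * m) fun n hn => by
    rw [coeff_momentPoly, if_neg (by omega)], ← Finset.sum_range_reflect, ← Finset.sum_neg_distrib]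
  refine Finset.sum_congr rfl fun j hj => ?_
  have hj' := Finset.mem_range.mp hj
  rw [coeff_momentPoly, if_pos (by omega), show 2 * m - 1 - (2 * m - 1 - j) = j by omega, smul_smul,
    ← neg_smul]
  congr 1
  have h1 : (-1 : ℂ) ^ (2 * m - 1 - j) * (-1) ^ j = -1 := by
    rw [← pow_add, show 2 * m - 1 - j + j = 2 * (m - 1) + 1 by omega, pow_succ, pow_mul]
    simp
  have h2 : (-1 : ℂ) ^ j * (-1) ^ j = 1 := by rw [← mul_pow]; simp
  linear_combination z ^ (2 * m - 1 - j) *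
    ((-1 : ℂ) ^ j * h1 - (-1 : ℂ) ^ (2 * m - 1 - j) * h2)

theorem MarkovEven.isMarkovPair {m : ℕ} {A s : ℕ → Mat q} (hmonic : A 0 = 1)
    (hM : MarkovEven q m A s) : IsMarkovPair m s (gPoly m A) (hPoly m A) := by
  obtain ⟨B, hB⟩ := hM
  refine ⟨fun n hn => ?_, ?_, fun n hn => ?_, fun n hn => ?_⟩
  · rw [gPoly, finsetSum_coeff]
    refine Finset.sum_eq_zero fun j hj => ?_
    have := Finset.mem_range.mp hj
    rw [coeff_monomial, if_neg (by omega)]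
  · rw [hPoly, finsetSum_coeff, Finset.sum_eq_single_of_mem 0 (by simp)]
    · simp [hmonic]
    · intro j hj h0
      have := Finset.mem_range.mp hj
      rw [coeff_monomial, if_neg (by omega)]
  · rw [hPoly, finsetSum_coeff]
    refine Finset.sum_eq_zero fun j hj => ?_
    rw [coeff_monomial, if_neg (by omega)]
  · have heq : X ^ (2 * m) * gPoly m A + momentPoly s (2 * m) * hPoly m A =
        ∑ k ∈ Finset.range m, monomial k (B k) := by
      apply eq_of_scalarEval_eq
      intro z
      have h1 := hB z
      simp only [map_add, map_mul, map_pow, map_sum, scalarEval_X, scalarEval_monomial,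
        scalarEval_hPoly, scalarEval_gPoly, scalarEval_momentPoly]
      rw [← h1, neg_mul, ← sub_eq_add_neg, _root_.smul_pow, one_pow, smul_mul_assoc, one_mul]
    rw [heq, finsetSum_coeff]
    refine Finset.sum_eq_zero fun k hk => ?_
    have := Finset.mem_range.mp hk
    rw [coeff_monomial, if_neg (by omega)]

theorem fPoly_eq_add (m : ℕ) (A : ℕ → Mat q) (z : ℂ) :
    fPoly q (2 * m) A z = hEven q m A (z ^ 2) + z • gEven q m A (z ^ 2) := by
  have hsplit : ∀ (F : ℕ → Mat q) (n : ℕ), ∑ j ∈ Finset.range (2 * n + 1), F j =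
      ∑ j ∈ Finset.range (n + 1), F (2 * j) + ∑ j ∈ Finset.range n, F (2 * j + 1) := by
    intro F n
    induction n with
    | zero => simp
    | succ n ih =>
      rw [show 2 * (n + 1) + 1 = 2 * n + 1 + 1 + 1 by ring, Finset.sum_range_succ,
        Finset.sum_range_succ, ih, Finset.sum_range_succ _ (n + 1), Finset.sum_range_succ (fun j => F (2 * j + 1)) n,
        show 2 * n + 1 + 1 = 2 * (n + 1) by ring]
      abel
  rw [fPoly, hsplit, hEven, gEven, Finset.smul_sum]
  congr 1
  · refine Finset.sum_congr rfl fun j _ => ?_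
    rw [← pow_mul, Nat.mul_sub]
  · refine Finset.sum_congr rfl fun j hj => ?_
    have := Finset.mem_range.mp hj
    rw [smul_smul, ← pow_mul, ← pow_succ', show 2 * (m - 1 - j) + 1 = 2 * m - (2 * j + 1) by omega]

theorem exists_isMarkovPair_moment {a c d : ℕ → Mat q} {m : ℕ} (hm : 0 < m)
    (ha : ∀ k, (a k).IsHermitian) (hM : a (2 * m) = 0) (hc : ∀ k < m, a (2 * k) * c k = 1)
    (hd : ∀ k < m, a (2 * k + 1) * d k = 1) :
    ∃ G H : (Mat q)[X], IsMarkovPair m (moment a) G H ∧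
      ∀ z : ℂ, (∀ j < m, IsUnit (wEven q m c d j z).det) →
        (∀ j, j + 1 < m → IsUnit (d (m - 2 - j) + (wEven q m c d j z)⁻¹).det) →
        scalarEval z G * (scalarEval z H)⁻¹ = (wEven q m c d (m - 1) z)⁻¹ := by
  have hcu : ∀ k < m, IsUnit (c k) := fun k hk => IsUnit.of_mul_eq_one_right _ (hc k hk)
  have hdu : ∀ k < m, IsUnit (d k) := fun k hk => IsUnit.of_mul_eq_one_right _ (hd k hk)
  set x := (tailPair c d m m).1 with hx
  set y := (tailPair c d m m).2 with hy
  have hlead : IsUnit (-y.coeff m) := (isUnit_coeff_tailPair hcu hdu le_rfl).neg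
  have hcoeff := coeff_tailPair c d m m
  obtain ⟨K, hK⟩ := hlead.exists_right_inv
  have hKu : IsUnit K := IsUnit.of_mul_eq_one_right _ hK
  have hstep : ∀ {R : Type} [Ring R] (t p u e v : R) (n : ℕ),
      -(t * ((-t) ^ n * u - p * v)) - e * v = (-t) ^ (n + 1) * u - (e - t * p) * v := by
    intro R _ t p u e v n
    rw [pow_succ']
    simp only [mul_sub, sub_mul, neg_mul, mul_assoc]
    abel
  have hfactor : ∀ {R : Type} [Ring R] (t p u v e : R) (n : ℕ),
      t ^ (2 * n) * (u * e) + p * (-v * e) = ((-t) ^ (2 * n) * u - p * v) * e := by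
    intro R _ t p u v e n
    rw [Even.neg_pow (even_two_mul n)]
    noncomm_ring
  have hiter : ∀ n, tailComb a c d m n = (-X) ^ n * x - momentPoly (moment a) n * y := by
    intro n
    induction n with
    | zero => simp [tailComb_zero a c d hm, momentPoly, hx]
    | succ n ih =>
      rw [tailComb_succ hm ha hM hc hd, ih, momentPoly, ← hy]
      exact hstep _ _ _ _ _ n
  refine ⟨x * C K, -y * C K, ⟨fun n hn => ?_, ?_, fun n hn => ?_, fun n hn => ?_⟩, ?_⟩
  · rw [coeff_mul_C, hcoeff.1 n hn, zero_mul]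
  · rw [coeff_mul_C, coeff_neg, hK]
  · rw [coeff_mul_C, coeff_neg, hcoeff.2 n hn]
    simp
  · have heq : X ^ (2 * m) * (x * C K) + momentPoly (moment a) (2 * m) * (-y * C K) =
        tailComb a c d m (2 * m) * C K := by
      rw [hiter]
      exact hfactor _ _ _ _ _ m
    rw [heq, coeff_mul_C, coeff_tailComb a c d m (2 * m) hn, zero_mul]
  · intro z hw hdw
    obtain ⟨hxu, hxy⟩ := wEven_mul_scalarEval_tailPair (t := m - 1) (by omega) hdu hw hdw
    rw [show m - 1 + 1 = m by omega, ← hx, ← hy] at hxy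
    rw [show m - 1 + 1 = m by omega, ← hx] at hxu
    have hH : scalarEval z (-y * C K) = wEven q m c d (m - 1) z * scalarEval z (x * C K) := by
      rw [map_mul, map_neg, ← hxy, map_mul, mul_assoc]
    have hGu : IsUnit (scalarEval z (x * C K)) := by
      rw [map_mul, scalarEval_C]
      exact hxu.mul hKu
    rw [hH, Matrix.mul_inv_rev, ← mul_assoc,
      Matrix.mul_nonsing_inv _ ((Matrix.isUnit_iff_isUnit_det _).mp hGu), one_mul]

theorem posDef_wEven {c d : ℕ → Mat q} {m j : ℕ} (hc : ∀ k < m, (c k).PosDef)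
    (hd : ∀ k < m, (d k).PosDef) {x : ℝ} (hx : 0 < x) (hj : j < m) :
    (wEven q m c d j x).PosDef := by
  have hx' : (0 : ℂ) < x := by exact_mod_cast hx
  induction j with
  | zero => exact ((hc _ (by omega)).smul hx').add (hd _ (by omega)).inv
  | succ j ih =>
    exact ((hc _ (by omega)).smul hx').add ((hd _ (by omega)).add (ih (by omega)).inv).inv

theorem exists_weights_of_isHTMEven {m : ℕ} {A s : ℕ → Mat q} (hm : 0 < m) (hmonic : A 0 = 1)
    (hM : MarkovEven q m A s) (h : IsHTMEven q m (hEven q m A) (gEven q m A)) :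
    ∃ a : ℕ → Mat q, (∀ k, (a k).IsHermitian) ∧ (∀ k < 2 * m, (a k).PosDef) ∧ a (2 * m) = 0 ∧
      ∀ n < 2 * m, moment a n = s n := by
  obtain ⟨c, d, hc, hd, hcf⟩ := h
  set a : ℕ → Mat q := fun k =>
    if k < 2 * m then (if k % 2 = 0 then (c (k / 2))⁻¹ else (d (k / 2))⁻¹) else 0 with ha
  have hpos : ∀ k < 2 * m, (a k).PosDef := by
    intro k hk
    simp only [ha, if_pos hk]
    split_ifs
    · exact (hc _ (by omega)).inv
    · exact (hd _ (by omega)).inv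
  have hherm : ∀ k, (a k).IsHermitian := by
    intro k
    by_cases hk : k < 2 * m
    · exact (hpos k hk).1
    · simp [ha, hk]
  have hzero : a (2 * m) = 0 := by simp [ha]
  have hac : ∀ k < m, a (2 * k) * c k = 1 := by
    intro k hk
    simp only [ha]
    rw [if_pos (by omega), if_pos (by omega), show 2 * k / 2 = k by omega]
    exact Matrix.nonsing_inv_mul _ ((Matrix.isUnit_iff_isUnit_det _).mp (hc k hk).isUnit)
  have had : ∀ k < m, a (2 * k + 1) * d k = 1 := by
    intro k hk
    simp only [ha]
    rw [if_pos (by omega), if_neg (by omega), show (2 * k + 1) / 2 = k by omega]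
    exact Matrix.nonsing_inv_mul _ ((Matrix.isUnit_iff_isUnit_det _).mp (hd k hk).isUnit)
  refine ⟨a, hherm, hpos, hzero, fun n hn => ?_⟩
  obtain ⟨G, H, hGH, hG⟩ := exists_isMarkovPair_moment hm hherm hzero hac had
  have hA := hM.isMarkovPair hmonic
  refine hGH.eq_of_mul_inv_eq hA ?_ hn
  filter_upwards [Filter.eventually_gt_atTop 0,
    eventually_det_scalarEval_ne_zero hA.leadingCoeff_den hA.coeff_den] with x hx hdet
  have hw : ∀ j < m, IsUnit (wEven q m c d j x).det := fun j hj =>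
    (Matrix.isUnit_iff_isUnit_det _).mp (posDef_wEven hc hd hx hj).isUnit
  have hdw : ∀ j, j + 1 < m → IsUnit (d (m - 2 - j) + (wEven q m c d j x)⁻¹).det := fun j hj =>
    (Matrix.isUnit_iff_isUnit_det _).mp
      ((hd _ (by omega)).add (posDef_wEven hc hd hx (by omega)).inv).isUnit
  rw [scalarEval_hPoly] at hdet
  rw [hG x hw hdw, scalarEval_gPoly, scalarEval_hPoly, hcf x hdet hw hdw]

theorem isHTMEven_of_posDef {m : ℕ} {A s : ℕ → Mat q} (hm : 0 < m) (hmonic : A 0 = 1)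
    (hM : MarkovEven q m A s) (h1 : (H1b q s m).PosDef) (h2 : (H2b q s m).PosDef) :
    IsHTMEven q m (hEven q m A) (gEven q m A) := by
  obtain ⟨a, hherm, hpos, hzero, hmom⟩ := exists_weights_of_posDef h1 h2 (2 * m) le_rfl
  have hmul : ∀ k < 2 * m, a k * (a k)⁻¹ = 1 := fun k hk =>
    Matrix.mul_nonsing_inv _ ((Matrix.isUnit_iff_isUnit_det _).mp (hpos k hk).isUnit)
  refine ⟨fun k => (a (2 * k))⁻¹, fun k => (a (2 * k + 1))⁻¹, fun k hk => (hpos _ (by omega)).inv,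
    fun k hk => (hpos _ (by omega)).inv, fun z _ hw hdw => ?_⟩
  obtain ⟨G, H, hGH, hG⟩ := exists_isMarkovPair_moment hm hherm (hzero _ le_rfl)
    (c := fun k => (a (2 * k))⁻¹) (d := fun k => (a (2 * k + 1))⁻¹)
    (fun k hk => hmul _ (by omega)) fun k hk => hmul _ (by omega)
  obtain ⟨rfl, rfl⟩ := (hGH.congr hmom).unique (hM.isMarkovPair hmonic) h1.isUnit
  rw [← hG z hw hdw, scalarEval_gPoly, scalarEval_hPoly]

end Main

theorem stmt_6 (q m : ℕ) (hq : 1 ≤ q) (hm : 1 ≤ m) (A s : ℕ → Mat q)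
    (hmonic : A 0 = 1) (hherm : ∀ j < 2 * m, (s j).IsHermitian)
    (hM : MarkovEven q m A s) :
    IsHTMEven q m (hEven q m A) (gEven q m A) ↔
      ((H1b q s m).PosDef ∧ (H2b q s m).PosDef ∧
        ∀ z : ℂ, fPoly q (2 * m) A z =
          (-1 : ℂ) ^ m •
            ((P1 q s m ((starRingEnd ℂ) (-z ^ 2)))ᴴ
              - z • (Q1 q s m ((starRingEnd ℂ) (-z ^ 2)))ᴴ)) := by
  refine ⟨fun h => ?_, fun ⟨h1, h2, _⟩ => isHTMEven_of_posDef hm hmonic hM h1 h2⟩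
  obtain ⟨a, ha, hpos, hzero, hmom⟩ := exists_weights_of_isHTMEven hm hmonic hM h
  have h1 : (H1b q s m).PosDef := by
    convert posDef_hankel_moment (e := 0) (by norm_num) ha hpos hzero using 1
    ext ⟨i, a⟩ ⟨j, b⟩
    simp only [H1b, blockMat, Matrix.of_apply]
    rw [hmom _ (by omega), add_zero]
  have h2 : (H2b q s m).PosDef := by
    convert posDef_hankel_moment (e := 1) (by norm_num) ha hpos hzero using 1
    ext ⟨i, a⟩ ⟨j, b⟩
    simp only [H2b, blockMat, Matrix.of_apply]
    rw [hmom _ (by omega)]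
  refine ⟨h1, h2, fun z => ?_⟩
  have hA := hM.isMarkovPair hmonic
  rw [fPoly_eq_add, ← scalarEval_hPoly, ← scalarEval_gPoly, hA.scalarEval_den h1,
    hA.scalarEval_num h1 hherm, pow_succ (-1 : ℂ)]
  simp [smul_comm z, sub_eq_add_neg]

end
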